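/- arXiv:math-ph/0402073 — 2 statements merged into one kernel-verified Lean document; each statement's English description precedes it below -/
import Mathlib

section
/- The number of standard Young tableaux of size 2n whose shape has all even row lengths (i.e., shape 2μ for some partition μ of n) equals the number of pairings of a 2n-element set, namely (2n-1)!!. -/
/-- `f` is a standard Young tableau of shape `μ`: it is a bijection from the cells of
`μ` onto `{1, …, |μ|}`, vanishing outside `μ`, and increasing along rows and columns. -/
def IsSYT (μ : YoungDiagram) (f : ℕ × ℕ → ℕ) : Prop :=
  Set.BijOn f ↑μ.cells (Set.Icc 1 μ.card) ∧
  (∀ x, x ∉ μ → f x = 0) ∧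
  (∀ i j, (i, j + 1) ∈ μ → f (i, j) < f (i, j + 1)) ∧
  (∀ i j, (i + 1, j) ∈ μ → f (i, j) < f (i + 1, j))

open Finset in
theorem Y_finite (n : ℕ) : {μ : YoungDiagram | μ.card = n}.Finite := by
  have key : ∀ μ : YoungDiagram, μ.card = n → μ.cells ⊆ range n ×ˢ range n := by
    rintro μ hμ ⟨i, j⟩ hx
    have hx' : (i, j) ∈ μ := hx
    rw [mem_product, mem_range, mem_range]
    constructor
    · have : ((range (i + 1)).image fun a => (a, j)) ⊆ μ.cells := by
        intro c hc
        obtain ⟨a, ha, rfl⟩ := mem_image.1 hc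
        exact μ.up_left_mem (by simp at ha; omega) le_rfl hx'
      have h2 := card_le_card this
      rw [card_image_of_injective _ (fun a b h => by simpa using h), card_range] at h2
      change i + 1 ≤ μ.card at h2
      simp only; omega
    · have : ((range (j + 1)).image fun a => (i, a)) ⊆ μ.cells := by
        intro c hc
        obtain ⟨a, ha, rfl⟩ := mem_image.1 hc
        exact μ.up_left_mem le_rfl (by simp at ha; omega) hx'
      have h2 := card_le_card this
      rw [card_image_of_injective _ (fun a b h => by simpa using h), card_range] at h2
      change j + 1 ≤ μ.card at h2
      simp only; omega
  refine Set.Finite.of_finite_image (f := YoungDiagram.cells)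
    ((range n ×ˢ range n).powerset.finite_toSet.subset ?_) ?_
  · rintro _ ⟨μ, hμ, rfl⟩
    exact Finset.mem_coe.2 (Finset.mem_powerset.2 (key μ hμ))
  · intro a _ b _ h
    exact YoungDiagram.ext h

/-- Diagrams with `n` cells. -/
noncomputable def Y (n : ℕ) : Finset YoungDiagram := (Y_finite n).toFinset

theorem mem_Y {n : ℕ} {μ : YoungDiagram} : μ ∈ Y n ↔ μ.card = n := by simp [Y]

/-- The number of SYT of a shape. -/
noncomputable def fN (μ : YoungDiagram) : ℕ := Nat.card {f : ℕ × ℕ → ℕ // IsSYT μ f}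

theorem finite_SYT (μ : YoungDiagram) : Finite {f : ℕ × ℕ → ℕ // IsSYT μ f} := by
  have hb : ∀ f : {f : ℕ × ℕ → ℕ // IsSYT μ f}, ∀ x : μ.cells, f.1 x.1 < μ.card + 1 := by
    intro f x
    have := f.2.1.mapsTo x.2
    simp at this; omega
  refine Finite.of_injective
    (fun f => fun x : μ.cells => (⟨f.1 x.1, hb f x⟩ : Fin (μ.card + 1))) ?_
  intro f g h
  apply Subtype.ext
  funext x
  by_cases hx : x ∈ μ
  · have := congrFun h ⟨x, hx⟩
    simpa using this
  · rw [f.2.2.1 x hx, g.2.2.1 x hx]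

theorem rowLen_ext {μ ν : YoungDiagram} (h : ∀ i, μ.rowLen i = ν.rowLen i) : μ = ν := by
  apply YoungDiagram.ext
  ext ⟨i, j⟩
  rw [YoungDiagram.mem_cells, YoungDiagram.mem_cells, YoungDiagram.mem_iff_lt_rowLen,
    YoungDiagram.mem_iff_lt_rowLen, h]

/-- `lam` is obtained from `nu` by adding a box in row `i`. -/
def Cov (nu lam : YoungDiagram) (i : ℕ) : Prop :=
  ∀ a, lam.rowLen a = nu.rowLen a + if a = i then 1 else 0

theorem rowLen_eq_of {μ : YoungDiagram} {i k : ℕ} (h : ∀ j, (i, j) ∈ μ ↔ j < k) :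
    μ.rowLen i = k := by
  have h1 := h (μ.rowLen i)
  have h2 := h k
  rw [YoungDiagram.mem_iff_lt_rowLen] at h1 h2
  omega

theorem exists_cov {nu lam : YoungDiagram} (hle : nu ≤ lam) (hc : lam.card = nu.card + 1) :
    ∃ i, Cov nu lam i := by
  have hs : nu.cells ⊆ lam.cells := hle
  have h1 : (lam.cells \ nu.cells).card = 1 := by
    rw [Finset.card_sdiff_of_subset hs]
    change lam.card - nu.card = 1
    omega
  obtain ⟨⟨i, j⟩, hx⟩ := Finset.card_eq_one.1 h1
  have hm : ∀ a b, b < lam.rowLen a ↔ b < nu.rowLen a ∨ (a = i ∧ b = j) := by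
    intro a b
    rw [← YoungDiagram.mem_iff_lt_rowLen, ← YoungDiagram.mem_iff_lt_rowLen]
    have := congrArg (fun s => (a, b) ∈ s) hx
    simp only [Finset.mem_sdiff, YoungDiagram.mem_cells, Finset.mem_singleton, Prod.mk.injEq,
      eq_iff_iff] at this
    have h3 : (a, b) ∈ nu → (a, b) ∈ lam := fun h => hs h
    tauto
  have hj : ¬ j < nu.rowLen i := by
    have : (i, j) ∈ lam.cells \ nu.cells := by rw [hx]; simp
    rw [Finset.mem_sdiff, YoungDiagram.mem_cells, YoungDiagram.mem_cells,
      YoungDiagram.mem_iff_lt_rowLen, YoungDiagram.mem_iff_lt_rowLen] at this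
    exact this.2
  refine ⟨i, fun a => ?_⟩
  have e1 := hm a (lam.rowLen a)
  have e2 := hm a (nu.rowLen a)
  have e3 := hm a (nu.rowLen a + 1)
  have e4 := hm a j
  split_ifs with h
  · subst h; simp only [true_and, or_true, iff_true] at e1 e2 e3 e4; omega
  · simp only [h, false_and, or_false] at e1 e2 e3 e4; omega

theorem cov_props {nu lam : YoungDiagram} {i : ℕ} (h : Cov nu lam i) :
    nu ≤ lam ∧ lam.card = nu.card + 1 := by
  have hm : ∀ a b, (a, b) ∈ lam ↔ (a, b) = (i, nu.rowLen i) ∨ (a, b) ∈ nu := by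
    intro a b
    rw [YoungDiagram.mem_iff_lt_rowLen, YoungDiagram.mem_iff_lt_rowLen, h a, Prod.mk.injEq]
    split_ifs with h'
    · subst h'; omega
    · simp [h']
  have hc : lam.cells = insert (i, nu.rowLen i) nu.cells := by
    ext ⟨a, b⟩
    rw [Finset.mem_insert]
    exact hm a b
  constructor
  · change nu.cells ⊆ lam.cells
    rw [hc]; exact Finset.subset_insert _ _
  · change lam.cells.card = nu.cells.card + 1
    rw [hc, Finset.card_insert_of_notMem]
    rw [YoungDiagram.mem_cells, YoungDiagram.mem_iff_lt_rowLen]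
    omega

theorem exists_add {nu : YoungDiagram} {i : ℕ}
    (h : i = 0 ∨ nu.rowLen i < nu.rowLen (i - 1)) : ∃ lam, Cov nu lam i := by
  refine ⟨⟨insert (i, nu.rowLen i) nu.cells, ?_⟩, ?_⟩
  · rintro ⟨a, b⟩ ⟨c, d⟩ hle hx
    obtain ⟨h1, h2⟩ := Prod.mk_le_mk.1 hle
    simp only [Finset.coe_insert, Set.mem_insert_iff, Prod.mk.injEq, Finset.mem_coe,
      YoungDiagram.mem_cells, YoungDiagram.mem_iff_lt_rowLen] at hx ⊢
    rcases hx with ⟨rfl, rfl⟩ | hx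
    · by_cases hci : c = a
      · subst hci; omega
      · right
        have := nu.rowLen_anti c (a - 1) (by omega)
        omega
    · right
      have := nu.rowLen_anti c a h1
      omega
  · intro a
    apply rowLen_eq_of
    intro j
    change (a, j) ∈ insert (i, nu.rowLen i) nu.cells ↔ _
    rw [Finset.mem_insert, YoungDiagram.mem_cells, YoungDiagram.mem_iff_lt_rowLen,
      Prod.mk.injEq]
    split_ifs with h'
    · subst h'; omega
    · simp [h']

theorem exists_rem {lam : YoungDiagram} {i : ℕ}
    (h : lam.rowLen (i + 1) < lam.rowLen i) : ∃ nu, Cov nu lam i := by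
  have hlow : IsLowerSet (↑(lam.cells.erase (i, lam.rowLen i - 1)) : Set (ℕ × ℕ)) := by
    rintro ⟨a, b⟩ ⟨c, d⟩ hle hx
    obtain ⟨h1, h2⟩ := Prod.mk_le_mk.1 hle
    simp only [Finset.coe_erase, Set.mem_sdiff, Set.mem_singleton_iff, Prod.mk.injEq,
      Finset.mem_coe, YoungDiagram.mem_cells, YoungDiagram.mem_iff_lt_rowLen] at hx ⊢
    have h3 := lam.rowLen_anti c a h1
    refine ⟨by omega, ?_⟩
    rintro ⟨rfl, rfl⟩
    by_cases hci : a = c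
    · subst hci; omega
    · have := lam.rowLen_anti (c + 1) a (by omega)
      omega
  refine ⟨⟨lam.cells.erase (i, lam.rowLen i - 1), hlow⟩, ?_⟩
  · intro a
    have : ∀ k, YoungDiagram.rowLen ⟨lam.cells.erase (i, lam.rowLen i - 1), k⟩ a =
        lam.rowLen a - if a = i then 1 else 0 := by
      intro k
      apply rowLen_eq_of
      intro j
      change (a, j) ∈ lam.cells.erase (i, lam.rowLen i - 1) ↔ _
      rw [Finset.mem_erase, YoungDiagram.mem_cells, YoungDiagram.mem_iff_lt_rowLen, ne_eq,
        Prod.mk.injEq]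
      split_ifs with h'
      · subst h'; omega
      · simp [h']
    have h4 := this hlow
    refine Eq.trans ?_ (congrArg (· + if a = i then 1 else 0) h4.symm)
    split_ifs with h'
    · subst h'; omega
    · rfl

theorem cov_addable {nu lam : YoungDiagram} {i : ℕ} (h : Cov nu lam i) :
    i = 0 ∨ nu.rowLen i < nu.rowLen (i - 1) := by
  by_cases h0 : i = 0
  · exact Or.inl h0
  · right
    have h1 := h i
    have h2 := h (i - 1)
    have h3 := lam.rowLen_anti (i - 1) i (by omega)
    rw [if_pos rfl] at h1
    rw [if_neg (by omega)] at h2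
    omega

theorem cov_removable {nu lam : YoungDiagram} {i : ℕ} (h : Cov nu lam i) :
    lam.rowLen (i + 1) < lam.rowLen i := by
  have h1 := h i
  have h2 := h (i + 1)
  have h3 := nu.rowLen_anti i (i + 1) (by omega)
  rw [if_pos rfl] at h1
  rw [if_neg (by omega)] at h2
  omega

theorem cov_idx {nu lam : YoungDiagram} {i j : ℕ} (h : Cov nu lam i) (h' : Cov nu lam j) :
    i = j := by
  by_contra hne
  have h1 := h i
  have h2 := h' i
  rw [if_pos rfl] at h1
  rw [if_neg hne] at h2
  omega

theorem cov_right {nu lam lam' : YoungDiagram} {i : ℕ} (h : Cov nu lam i) (h' : Cov nu lam' i) :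
    lam = lam' := rowLen_ext fun a => by rw [h a, h' a]

theorem cov_left {nu nu' lam : YoungDiagram} {i : ℕ} (h : Cov nu lam i) (h' : Cov nu' lam i) :
    nu = nu' := rowLen_ext fun a => by have := h a; have := h' a; omega

open Classical in
theorem card_up_down {m : ℕ} {nu : YoungDiagram} (hn : nu ∈ Y (m + 1)) :
    ((Y (m + 2)).filter (nu ≤ ·)).card = ((Y m).filter (· ≤ nu)).card + 1 := by
  rw [mem_Y] at hn
  have hup : ∀ lam ∈ (Y (m + 2)).filter (nu ≤ ·), ∃ i, Cov nu lam i := by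
    intro lam h
    rw [Finset.mem_filter, mem_Y] at h
    exact exists_cov h.2 (by omega)
  have hdn : ∀ mu ∈ (Y m).filter (· ≤ nu), ∃ i, Cov mu nu i := by
    intro lam h
    rw [Finset.mem_filter, mem_Y] at h
    exact exists_cov h.2 (by omega)
  have hz : ∃ N, ∀ i, nu.rowLen (i + 1) < nu.rowLen i → i < N := by
    refine ⟨nu.colLen 0, fun i hi => ?_⟩
    rw [← YoungDiagram.mem_iff_lt_colLen, YoungDiagram.mem_iff_lt_rowLen]
    omega
  obtain ⟨N, hN⟩ := hz
  set R := (Finset.range N).filter fun i => nu.rowLen (i + 1) < nu.rowLen i with hR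
  have hmR : ∀ i, i ∈ R ↔ nu.rowLen (i + 1) < nu.rowLen i := by
    intro i
    rw [hR, Finset.mem_filter, Finset.mem_range]
    exact ⟨fun h => h.2, fun h => ⟨hN i h, h⟩⟩
  have hA : (insert 0 (R.image Nat.succ)).card = R.card + 1 := by
    rw [Finset.card_insert_of_notMem (by simp), Finset.card_image_of_injective _ Nat.succ_injective]
  have h1 : ((Y (m + 2)).filter (nu ≤ ·)).card = (insert 0 (R.image Nat.succ)).card := by
    choose g hg using hup
    refine Finset.card_bij g ?_ ?_ ?_
    · intro a ha
      rcases cov_addable (hg a ha) with h | h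
      · simp [h]
      · refine Finset.mem_insert_of_mem (Finset.mem_image.2 ⟨g a ha - 1, ?_, ?_⟩)
        · rw [hmR]
          have : g a ha ≠ 0 := by
            intro h0; simp [h0] at h
          rwa [Nat.sub_add_cancel (by omega)]
        · have : g a ha ≠ 0 := by
            intro h0; simp [h0] at h
          simp only [Nat.succ_eq_add_one]; omega
    · intro a ha b hb hab
      have h1 := hg a ha
      rw [hab] at h1
      exact cov_right h1 (hg b hb)
    · intro i hi
      have : i = 0 ∨ nu.rowLen i < nu.rowLen (i - 1) := by
        rcases Finset.mem_insert.1 hi with h | h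
        · exact Or.inl h
        · obtain ⟨k, hk, rfl⟩ := Finset.mem_image.1 h
          exact Or.inr ((hmR k).1 hk)
      obtain ⟨lam, hl⟩ := exists_add this
      have hp := cov_props hl
      have hmem : lam ∈ (Y (m + 2)).filter (nu ≤ ·) := by
        rw [Finset.mem_filter, mem_Y]; exact ⟨by omega, hp.1⟩
      exact ⟨lam, hmem, cov_idx (hg lam hmem) hl⟩
  have h2 : ((Y m).filter (· ≤ nu)).card = R.card := by
    choose g hg using hdn
    refine Finset.card_bij g ?_ ?_ ?_
    · intro a ha
      exact (hmR _).2 (cov_removable (hg a ha))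
    · intro a ha b hb hab
      have h1 := hg a ha
      rw [hab] at h1
      exact cov_left h1 (hg b hb)
    · intro i hi
      obtain ⟨lam, hl⟩ := exists_rem ((hmR i).1 hi)
      have hp := cov_props hl
      have hmem : lam ∈ (Y m).filter (· ≤ nu) := by
        rw [Finset.mem_filter, mem_Y]; exact ⟨by omega, hp.1⟩
      exact ⟨lam, hmem, cov_idx (hg lam hmem) hl⟩
  rw [h1, h2, hA]

theorem eq_of_le_card {mu nu : YoungDiagram} (h : mu ≤ nu) (hc : nu.card ≤ mu.card) :
    mu = nu :=
  YoungDiagram.ext (Finset.eq_of_subset_of_card_le h hc)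

theorem card_mono {mu nu : YoungDiagram} (h : mu ≤ nu) : mu.card ≤ nu.card :=
  Finset.card_le_card h

open Classical in
theorem card_common {m : ℕ} {lam nu : YoungDiagram} (hl : lam ∈ Y (m + 1)) (hn : nu ∈ Y (m + 1)) :
    ((Y (m + 2)).filter fun mu => lam ≤ mu ∧ nu ≤ mu).card =
      ((Y m).filter fun ka => ka ≤ lam ∧ ka ≤ nu).card + if nu = lam then 1 else 0 := by
  split_ifs with h
  · subst h
    simpa using card_up_down hn
  · rw [mem_Y] at hl hn
    have hsum : (lam ⊔ nu).card + (lam ⊓ nu).card = 2 * (m + 1) := by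
      have := Finset.card_union_add_card_inter lam.cells nu.cells
      change (lam ⊔ nu).card + (lam ⊓ nu).card = lam.card + nu.card at this
      omega
    have hge : m + 2 ≤ (lam ⊔ nu).card := by
      by_contra hlt
      have h1 := eq_of_le_card (le_sup_left : lam ≤ lam ⊔ nu) (by omega)
      have h2 := eq_of_le_card (le_sup_right : nu ≤ lam ⊔ nu) (by omega)
      exact h (h2.trans h1.symm)
    by_cases he : (lam ⊔ nu).card = m + 2
    · have h1 : ((Y (m + 2)).filter fun mu => lam ≤ mu ∧ nu ≤ mu) = {lam ⊔ nu} := by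
        ext mu
        rw [Finset.mem_filter, mem_Y, Finset.mem_singleton, ← sup_le_iff]
        constructor
        · rintro ⟨h3, h4⟩
          exact (eq_of_le_card h4 (by omega)).symm
        · rintro rfl; exact ⟨he, le_rfl⟩
      have h2 : ((Y m).filter fun mu => mu ≤ lam ∧ mu ≤ nu) = {lam ⊓ nu} := by
        ext mu
        rw [Finset.mem_filter, mem_Y, Finset.mem_singleton, ← le_inf_iff]
        constructor
        · rintro ⟨h3, h4⟩
          exact (eq_of_le_card h4 (by omega))
        · rintro rfl; exact ⟨by omega, le_rfl⟩
      rw [h1, h2]; simp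
    · have h1 : ((Y (m + 2)).filter fun mu => lam ≤ mu ∧ nu ≤ mu) = ∅ := by
        ext mu
        rw [Finset.mem_filter, mem_Y, ← sup_le_iff]
        simp only [Finset.notMem_empty, iff_false]
        rintro ⟨h3, h4⟩
        have := card_mono h4
        omega
      have h2 : ((Y m).filter fun mu => mu ≤ lam ∧ mu ≤ nu) = ∅ := by
        ext mu
        rw [Finset.mem_filter, mem_Y, ← le_inf_iff]
        simp only [Finset.notMem_empty, iff_false]
        rintro ⟨h3, h4⟩
        have := card_mono h4
        omega
      rw [h1, h2]; simp

/-- All rows even. -/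
def Ev (mu : YoungDiagram) : Prop := ∀ i, Even (mu.rowLen i)

theorem ev_cov_up {nu lam : YoungDiagram} {i : ℕ} (h : Cov nu lam i) (he : Ev lam) :
    ∀ a, Odd (nu.rowLen a) ↔ a = i := by
  intro a
  have h1 := h a
  have h2 := he a
  rw [h1] at h2
  split_ifs at h2 with h3 <;> grind

theorem ev_cov_dn {nu lam : YoungDiagram} {i : ℕ} (h : Cov nu lam i) (he : Ev nu) :
    ∀ a, Odd (lam.rowLen a) ↔ a = i := by
  intro a
  have h1 := h a
  have h2 := he a
  split_ifs at h1 with h3 <;> grind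

open Classical in
theorem card_ev {m : ℕ} {nu : YoungDiagram} (hn : nu ∈ Y (m + 1)) :
    ((Y (m + 2)).filter fun lam => Ev lam ∧ nu ≤ lam).card =
      ((Y m).filter fun mu => Ev mu ∧ mu ≤ nu).card := by
  rw [mem_Y] at hn
  have hup : ∀ lam ∈ (Y (m + 2)).filter (fun lam => Ev lam ∧ nu ≤ lam),
      ∃ i, Cov nu lam i ∧ Ev lam := by
    intro lam h
    rw [Finset.mem_filter, mem_Y] at h
    obtain ⟨i, hi⟩ := exists_cov h.2.2 (by omega)
    exact ⟨i, hi, h.2.1⟩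
  have hdn : ∀ mu ∈ (Y m).filter (fun mu => Ev mu ∧ mu ≤ nu), ∃ i, Cov mu nu i ∧ Ev mu := by
    intro lam h
    rw [Finset.mem_filter, mem_Y] at h
    obtain ⟨i, hi⟩ := exists_cov h.2.2 (by omega)
    exact ⟨i, hi, h.2.1⟩
  by_cases hi : ∃ i, ∀ a, Odd (nu.rowLen a) ↔ a = i
  · obtain ⟨i, hi⟩ := hi
    have hio : Odd (nu.rowLen i) := (hi i).2 rfl
    have hev : ∀ a, a ≠ i → Even (nu.rowLen a) := by
      intro a ha
      rw [← Nat.not_odd_iff_even, hi]; exact ha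
    have hadd : i = 0 ∨ nu.rowLen i < nu.rowLen (i - 1) := by
      by_cases h0 : i = 0
      · exact Or.inl h0
      · right
        have h1 := hev (i - 1) (by omega)
        have h2 := nu.rowLen_anti (i - 1) i (by omega)
        refine lt_of_le_of_ne h2 fun h => ?_
        rw [← h, ← Nat.not_odd_iff_even] at h1
        exact h1 hio
    have hrem : nu.rowLen (i + 1) < nu.rowLen i := by
      have h1 := hev (i + 1) (by omega)
      have h2 := nu.rowLen_anti i (i + 1) (by omega)
      refine lt_of_le_of_ne h2 fun h => ?_
      rw [h, ← Nat.not_odd_iff_even] at h1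
      exact h1 hio
    obtain ⟨lam, hlam⟩ := exists_add hadd
    obtain ⟨mu, hmu⟩ := exists_rem hrem
    have hl := cov_props hlam
    have hm := cov_props hmu
    have h1 : (Y (m + 2)).filter (fun lam => Ev lam ∧ nu ≤ lam) = {lam} := by
      ext x
      rw [Finset.mem_singleton]
      constructor
      · intro hx
        obtain ⟨j, hj, hje⟩ := hup x hx
        have : i = j := (ev_cov_up hj hje i).1 hio
        subst this
        exact cov_right hj hlam
      · rintro rfl
        rw [Finset.mem_filter, mem_Y]
        refine ⟨by omega, ?_, hl.1⟩
        intro a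
        have := hlam a
        have h3 := hev a
        rw [this]
        split_ifs with h4
        · subst h4; exact hio.add_one
        · exact h3 h4
    have h2 : (Y m).filter (fun mu => Ev mu ∧ mu ≤ nu) = {mu} := by
      ext x
      rw [Finset.mem_singleton]
      constructor
      · intro hx
        obtain ⟨j, hj, hje⟩ := hdn x hx
        have : i = j := (ev_cov_dn hj hje i).1 hio
        subst this
        exact cov_left hj hmu
      · rintro rfl
        rw [Finset.mem_filter, mem_Y]
        refine ⟨by omega, ?_, hm.1⟩
        intro a
        have := hmu a
        have h3 := hev a
        split_ifs at this with h4
        · subst h4; rw [this] at hio; grind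
        · rw [this] at h3; exact h3 h4
    rw [h1, h2]; simp
  · have h1 : (Y (m + 2)).filter (fun lam => Ev lam ∧ nu ≤ lam) = ∅ := by
      rw [Finset.eq_empty_iff_forall_notMem]
      intro x hx
      obtain ⟨j, hj, hje⟩ := hup x hx
      exact hi ⟨j, ev_cov_up hj hje⟩
    have h2 : (Y m).filter (fun mu => Ev mu ∧ mu ≤ nu) = ∅ := by
      rw [Finset.eq_empty_iff_forall_notMem]
      intro x hx
      obtain ⟨j, hj, hje⟩ := hdn x hx
      exact hi ⟨j, ev_cov_dn hj hje⟩
    rw [h1, h2]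

/-- The diagram of entries at most `n`. -/
def subDiag (lam : YoungDiagram) (f : ℕ × ℕ → ℕ) (hf : IsSYT lam f) (n : ℕ) : YoungDiagram where
  cells := lam.cells.filter fun x => f x ≤ n
  isLowerSet := by
    have hr : ∀ i j k, (i, j + k) ∈ lam → f (i, j) ≤ f (i, j + k) := by
      intro i j k
      induction k with
      | zero => intro _; exact le_rfl
      | succ k ih =>
        intro h
        exact (ih (lam.up_left_mem le_rfl (by omega) h)).trans (hf.2.2.1 i (j + k) h).le
    have hc : ∀ i j k, (i + k, j) ∈ lam → f (i, j) ≤ f (i + k, j) := by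
      intro i j k
      induction k with
      | zero => intro _; exact le_rfl
      | succ k ih =>
        intro h
        exact (ih (lam.up_left_mem (by omega) le_rfl h)).trans (hf.2.2.2 (i + k) j h).le
    rintro ⟨a, b⟩ ⟨c, d⟩ hle hx
    obtain ⟨h1, h2⟩ := Prod.mk_le_mk.1 hle
    obtain ⟨k, rfl⟩ := Nat.exists_eq_add_of_le h1
    obtain ⟨l, rfl⟩ := Nat.exists_eq_add_of_le h2
    simp only [Finset.coe_filter, Set.mem_ofPred_eq, YoungDiagram.mem_cells] at hx ⊢
    refine ⟨lam.up_left_mem h1 h2 hx.1, ?_⟩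
    have e1 := hr (c + k) d l hx.1
    have e2 := hc c d k (lam.up_left_mem le_rfl h2 hx.1)
    omega

theorem mem_subDiag {lam : YoungDiagram} {f : ℕ × ℕ → ℕ} {hf : IsSYT lam f} {n : ℕ}
    {x : ℕ × ℕ} : x ∈ subDiag lam f hf n ↔ x ∈ lam ∧ f x ≤ n := by
  rw [← YoungDiagram.mem_cells]
  simp [subDiag]

theorem card_subDiag {lam : YoungDiagram} {f : ℕ × ℕ → ℕ} (hf : IsSYT lam f) {n : ℕ}
    (hn : n ≤ lam.card) : (subDiag lam f hf n).card = n := by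
  have : (subDiag lam f hf n).cells.card = (Finset.Icc 1 n).card := by
    refine Finset.card_bij (fun x _ => f x) ?_ ?_ ?_
    · intro x hx
      rw [YoungDiagram.mem_cells, mem_subDiag] at hx
      have := hf.1.mapsTo hx.1
      simp at this ⊢; omega
    · intro x hx y hy h
      rw [YoungDiagram.mem_cells, mem_subDiag] at hx hy
      exact hf.1.injOn hx.1 hy.1 h
    · intro k hk
      have hk' : k ∈ Set.Icc 1 lam.card := by simp at hk ⊢; omega
      obtain ⟨x, hx, rfl⟩ := hf.1.surjOn hk'
      refine ⟨x, ?_, rfl⟩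
      rw [YoungDiagram.mem_cells, mem_subDiag]
      simp at hk
      exact ⟨hx, hk.2⟩
  simpa [YoungDiagram.card] using this

theorem isSYT_restrict {lam : YoungDiagram} {f : ℕ × ℕ → ℕ} (hf : IsSYT lam f) {n : ℕ}
    (hn : n ≤ lam.card) : IsSYT (subDiag lam f hf n) (fun x => if f x ≤ n then f x else 0) := by
  refine ⟨⟨?_, ?_, ?_⟩, ?_, ?_, ?_⟩
  · intro x hx
    have hx : x ∈ subDiag lam f hf n := hx
    rw [mem_subDiag] at hx
    have := hf.1.mapsTo hx.1
    rw [card_subDiag hf hn]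
    simp only [hx.2, if_true]
    exact ⟨this.1, hx.2⟩
  · intro x hx y hy h
    have hx : x ∈ subDiag lam f hf n := hx
    have hy : y ∈ subDiag lam f hf n := hy
    rw [mem_subDiag] at hx hy
    simp only [hx.2, hy.2, if_true] at h
    exact hf.1.injOn hx.1 hy.1 h
  · intro k hk
    rw [card_subDiag hf hn] at hk
    obtain ⟨x, hx, rfl⟩ := hf.1.surjOn (show k ∈ Set.Icc 1 lam.card from ⟨hk.1, hk.2.trans hn⟩)
    refine ⟨x, ?_, by simp only [hk.2, if_true]⟩
    change x ∈ subDiag lam f hf n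
    rw [mem_subDiag]
    exact ⟨hx, hk.2⟩
  · intro x hx
    rw [mem_subDiag] at hx
    by_cases h : f x ≤ n
    · simp only [h, if_true]
      exact hf.2.1 x fun h' => hx ⟨h', h⟩
    · simp [h]
  · intro i j h
    rw [mem_subDiag] at h
    have := hf.2.2.1 i j h.1
    simp only [h.2, if_true, this.le.trans h.2]
    exact this
  · intro i j h
    rw [mem_subDiag] at h
    have := hf.2.2.2 i j h.1
    simp only [h.2, if_true, this.le.trans h.2]
    exact this

open Classical in
theorem isSYT_extend {n : ℕ} {nu lam : YoungDiagram} (hle : nu ≤ lam) (hn : nu.card = n)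
    (hl : lam.card = n + 1) {g : ℕ × ℕ → ℕ} (hg : IsSYT nu g) :
    IsSYT lam (fun x => if x ∈ nu then g x else if x ∈ lam then n + 1 else 0) := by
  have hs : nu.cells ⊆ lam.cells := hle
  have h1 : (lam.cells \ nu.cells).card = 1 := by
    rw [Finset.card_sdiff_of_subset hs]
    change lam.card - nu.card = 1
    omega
  obtain ⟨c, hc⟩ := Finset.card_eq_one.1 h1
  have hc' : ∀ x, x ∈ lam → x ∉ nu → x = c := by
    intro x h h'
    have : x ∈ lam.cells \ nu.cells := Finset.mem_sdiff.2 ⟨h, h'⟩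
    rw [hc] at this
    simpa using this
  have hcl : c ∈ lam ∧ c ∉ nu := by
    have : c ∈ lam.cells \ nu.cells := by rw [hc]; simp
    exact Finset.mem_sdiff.1 this
  have hb : ∀ x ∈ nu, 1 ≤ g x ∧ g x ≤ n := by
    intro x hx
    have := hg.1.mapsTo hx
    rw [hn] at this
    exact this
  refine ⟨⟨?_, ?_, ?_⟩, ?_, ?_, ?_⟩
  · intro x hx
    have hx : x ∈ lam := hx
    rw [hl]
    by_cases h : x ∈ nu
    · have := hb x h
      simp only [h, if_true]
      exact ⟨this.1, by omega⟩
    · simp only [h, hx, if_true, if_false]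
      exact ⟨by omega, le_rfl⟩
  · intro x hx y hy h
    have hx : x ∈ lam := hx
    have hy : y ∈ lam := hy
    by_cases h1 : x ∈ nu <;> by_cases h2 : y ∈ nu <;> simp only [h1, h2, hx, hy, if_true, if_false] at h
    · exact hg.1.injOn h1 h2 h
    · have := hb x h1; omega
    · have := hb y h2; omega
    · rw [hc' x hx h1, hc' y hy h2]
  · intro k hk
    rw [hl] at hk
    by_cases h : k = n + 1
    · refine ⟨c, hcl.1, ?_⟩
      simp only [hcl.1, hcl.2, if_true, if_false, h]
    · obtain ⟨x, hx, rfl⟩ := hg.1.surjOn (show k ∈ Set.Icc 1 nu.card from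
        ⟨hk.1, by have := hk.2; omega⟩)
      have hx : x ∈ nu := hx
      refine ⟨x, hs hx, by simp only [hx, if_true]⟩
  · intro x hx
    have : x ∉ nu := fun h => hx (hs h)
    simp only [hx, this, if_false]
  · intro i j h
    by_cases h1 : (i, j + 1) ∈ nu
    · have h2 : (i, j) ∈ nu := nu.up_left_mem le_rfl (by omega) h1
      simp only [h1, h2, if_true]
      exact hg.2.2.1 i j h1
    · have h2 : (i, j) ∈ nu := by
        by_contra h2
        have e1 := hc' _ h h1
        have e2 := hc' _ (lam.up_left_mem le_rfl (by omega) h) h2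
        have := e1.trans e2.symm
        simp at this
      have := hb _ h2
      simp only [h1, h2, h, if_true, if_false]
      omega
  · intro i j h
    by_cases h1 : (i + 1, j) ∈ nu
    · have h2 : (i, j) ∈ nu := nu.up_left_mem (by omega) le_rfl h1
      simp only [h1, h2, if_true]
      exact hg.2.2.2 i j h1
    · have h2 : (i, j) ∈ nu := by
        by_contra h2
        have e1 := hc' _ h h1
        have e2 := hc' _ (lam.up_left_mem (by omega) le_rfl h) h2
        have := e1.trans e2.symm
        simp at this
      have := hb _ h2
      simp only [h1, h2, h, if_true, if_false]
      omega

/-- Standard tableaux on a finite set of shapes are counted by the sum. -/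
theorem card_sum_shapes (S : Finset YoungDiagram) :
    Nat.card {p : YoungDiagram × (ℕ × ℕ → ℕ) // p.1 ∈ S ∧ IsSYT p.1 p.2} = ∑ nu ∈ S, fN nu := by
  have e : {p : YoungDiagram × (ℕ × ℕ → ℕ) // p.1 ∈ S ∧ IsSYT p.1 p.2} ≃
      (Σ nu : S, {f : ℕ × ℕ → ℕ // IsSYT nu.1 f}) :=
    { toFun := fun p => ⟨⟨p.1.1, p.2.1⟩, ⟨p.1.2, p.2.2⟩⟩
      invFun := fun q => ⟨(q.1.1, q.2.1), q.1.2, q.2.2⟩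
      left_inv := fun _ => rfl
      right_inv := fun _ => rfl }
  have : ∀ nu : S, Finite {f : ℕ × ℕ → ℕ // IsSYT nu.1 f} := fun nu => finite_SYT nu.1
  rw [Nat.card_congr e, Nat.card_sigma, ← Finset.sum_coe_sort S]
  rfl

open Classical in
theorem fN_rec {n : ℕ} {lam : YoungDiagram} (hl : lam ∈ Y (n + 1)) :
    fN lam = ∑ nu ∈ (Y n).filter (· ≤ lam), fN nu := by
  rw [mem_Y] at hl
  rw [← card_sum_shapes, fN]
  refine Nat.card_eq_of_bijective (fun f => ⟨(subDiag lam f.1 f.2 n,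
    fun x => if f.1 x ≤ n then f.1 x else 0), ?_, isSYT_restrict f.2 (by omega)⟩) ⟨?_, ?_⟩
  · rw [Finset.mem_filter, mem_Y]
    refine ⟨card_subDiag f.2 (by omega), ?_⟩
    intro x hx
    exact (mem_subDiag (hf := f.2).1 hx).1
  · rintro ⟨f, hf⟩ ⟨g, hg⟩ h
    apply Subtype.ext
    simp only [Subtype.mk.injEq, Prod.mk.injEq] at h
    obtain ⟨h1, h2⟩ := h
    funext x
    by_cases hx : x ∈ lam
    · have h3 : (x ∈ lam ∧ f x ≤ n) ↔ (x ∈ lam ∧ g x ≤ n) := by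
        rw [← mem_subDiag (hf := hf), ← mem_subDiag (hf := hg), h1]
      have h4 := congrFun h2 x
      have h5 := hf.1.mapsTo hx
      have h6 := hg.1.mapsTo hx
      rw [hl] at h5 h6
      have h51 := h5.2
      have h61 := h6.2
      simp only [hx, true_and] at h3
      by_cases h7 : f x ≤ n
      · rw [if_pos h7, if_pos (h3.1 h7)] at h4
        exact h4
      · have : ¬ g x ≤ n := fun h => h7 (h3.2 h)
        change f x = g x
        omega
    · exact (hf.2.1 x hx).trans (hg.2.1 x hx).symm
  · rintro ⟨⟨nu, g⟩, hnu, hg⟩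
    simp only at hnu hg
    rw [Finset.mem_filter, mem_Y] at hnu
    have hb : ∀ x ∈ nu, 1 ≤ g x ∧ g x ≤ n := by
      intro x hx
      have := hg.1.mapsTo hx
      rw [hnu.1] at this
      exact this
    have hs : ∀ x, x ∈ nu → x ∈ lam := fun x hx => hnu.2 hx
    refine ⟨⟨_, isSYT_extend hnu.2 hnu.1 hl hg⟩, ?_⟩
    apply Subtype.ext
    refine Prod.ext ?_ ?_
    · apply SetLike.ext
      intro x
      rw [mem_subDiag]
      by_cases hx : x ∈ nu
      · simp only [hx, if_true, hs x hx, true_and, iff_true]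
        exact (hb x hx).2
      · simp only [hx, if_false, iff_false]
        rintro ⟨h1, h2⟩
        rw [if_pos h1] at h2
        omega
    · funext x
      by_cases hx : x ∈ nu
      · simp only [hx, if_true, (hb x hx).2]
      · have := hg.2.1 x hx
        by_cases h1 : x ∈ lam
        · simp [hx, h1, this]
        · simp [hx, h1, this]

theorem Y_zero : Y 0 = {⊥} := by
  ext mu
  rw [mem_Y, Finset.mem_singleton]
  constructor
  · intro h
    exact (eq_of_le_card bot_le (by omega)).symm
  · rintro rfl; rfl

theorem fN_bot : fN ⊥ = 1 := by
  rw [fN, Nat.card_eq_one_iff_unique]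
  have hc : (⊥ : YoungDiagram).card = 0 := rfl
  refine ⟨⟨?_⟩, ⟨⟨fun _ => 0, ?_, ?_, ?_, ?_⟩⟩⟩
  · rintro ⟨f, hf⟩ ⟨g, hg⟩
    apply Subtype.ext
    funext x
    exact (hf.2.1 x (YoungDiagram.notMem_bot x)).trans (hg.2.1 x (YoungDiagram.notMem_bot x)).symm
  · rw [hc]; simp
  · intro _ _; rfl
  · intro i j h; exact absurd h (YoungDiagram.notMem_bot _)
  · intro i j h; exact absurd h (YoungDiagram.notMem_bot _)

open Classical in
theorem Y_one_card : (Y 1).card = 1 := by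
  have h0 : ∀ i, (⊥ : YoungDiagram).rowLen i = 0 := by
    intro i
    apply rowLen_eq_of
    intro j
    simp
  have hc : (⊥ : YoungDiagram).card = 0 := rfl
  obtain ⟨lam, hlam⟩ := exists_add (nu := ⊥) (i := 0) (Or.inl rfl)
  rw [Finset.card_eq_one]
  refine ⟨lam, ?_⟩
  ext x
  rw [mem_Y, Finset.mem_singleton]
  constructor
  · intro hx
    obtain ⟨i, hi⟩ := exists_cov (bot_le : ⊥ ≤ x) (by omega)
    have : i = 0 := by
      rcases cov_addable hi with h | h
      · exact h
      · rw [h0, h0] at h; omega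
    subst this
    exact cov_right hi hlam
  · rintro rfl
    have := (cov_props hlam).2
    omega

open Classical in
theorem sum_up (n : ℕ) : ∀ lam ∈ Y n,
    ∑ mu ∈ (Y (n + 1)).filter (lam ≤ ·), fN mu = (n + 1) * fN lam := by
  induction n with
  | zero =>
    intro lam hl
    rw [Y_zero, Finset.mem_singleton] at hl
    subst hl
    have h1 : ∀ mu ∈ Y 1, fN mu = 1 := by
      intro mu hmu
      rw [fN_rec (n := 0) hmu, Y_zero, Finset.filter_true_of_mem (by simp), Finset.sum_singleton,
        fN_bot]
    rw [Finset.filter_true_of_mem (fun _ _ => bot_le), Finset.sum_congr rfl h1]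
    simp [Y_one_card, fN_bot]
  | succ m ih =>
    intro lam hl
    have e1 : ∑ mu ∈ (Y (m + 2)).filter (lam ≤ ·), fN mu =
        ∑ nu ∈ Y (m + 1), ((Y (m + 2)).filter fun mu => lam ≤ mu ∧ nu ≤ mu).card * fN nu := by
      rw [Finset.sum_congr rfl fun mu hmu => fN_rec (n := m + 1) (Finset.mem_filter.1 hmu).1]
      simp_rw [Finset.sum_filter (s := Y (m + 1))]
      rw [Finset.sum_comm]
      refine Finset.sum_congr rfl fun nu _ => ?_
      rw [← Finset.sum_filter, Finset.filter_filter, Finset.sum_const, smul_eq_mul]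
    have e2 : ∑ ka ∈ (Y m).filter (· ≤ lam), ∑ nu ∈ (Y (m + 1)).filter (ka ≤ ·), fN nu =
        ∑ nu ∈ Y (m + 1), ((Y m).filter fun ka => ka ≤ lam ∧ ka ≤ nu).card * fN nu := by
      simp_rw [Finset.sum_filter (s := Y (m + 1))]
      rw [Finset.sum_comm]
      refine Finset.sum_congr rfl fun nu _ => ?_
      rw [← Finset.sum_filter, Finset.filter_filter, Finset.sum_const, smul_eq_mul]
    have e3 : ∑ ka ∈ (Y m).filter (· ≤ lam), ∑ nu ∈ (Y (m + 1)).filter (ka ≤ ·), fN nu =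
        (m + 1) * fN lam := by
      rw [Finset.sum_congr rfl fun ka hka => ih ka (Finset.mem_filter.1 hka).1,
        ← Finset.mul_sum, ← fN_rec hl]
    rw [e1, Finset.sum_congr rfl fun nu hnu => by rw [card_common hl hnu, add_mul],
      Finset.sum_add_distrib, ← e2, e3]
    simp only [ite_mul, one_mul, zero_mul, Finset.sum_ite_eq', hl, if_true]
    ring

open Classical in
/-- The number of SYT with `2n` cells and even rows. -/
noncomputable def eN (n : ℕ) : ℕ := ∑ lam ∈ (Y (2 * n)).filter Ev, fN lam

open Classical in
theorem eN_succ (n : ℕ) : eN (n + 1) = (2 * n + 1) * eN n := by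
  have e1 : eN (n + 1) = ∑ nu ∈ Y (2 * n + 1),
      ((Y (2 * n + 2)).filter fun lam => Ev lam ∧ nu ≤ lam).card * fN nu := by
    rw [eN, show 2 * (n + 1) = 2 * n + 2 by ring,
      Finset.sum_congr rfl fun mu hmu => fN_rec (n := 2 * n + 1) (Finset.mem_filter.1 hmu).1]
    simp_rw [Finset.sum_filter (s := Y (2 * n + 1))]
    rw [Finset.sum_comm]
    refine Finset.sum_congr rfl fun nu _ => ?_
    rw [← Finset.sum_filter, Finset.filter_filter, Finset.sum_const, smul_eq_mul]
  have e2 : (2 * n + 1) * eN n = ∑ nu ∈ Y (2 * n + 1),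
      ((Y (2 * n)).filter fun mu => Ev mu ∧ mu ≤ nu).card * fN nu := by
    rw [eN, Finset.mul_sum,
      Finset.sum_congr rfl fun mu hmu => (sum_up (2 * n) mu (Finset.mem_filter.1 hmu).1).symm]
    simp_rw [Finset.sum_filter (s := Y (2 * n + 1))]
    rw [Finset.sum_comm]
    refine Finset.sum_congr rfl fun nu _ => ?_
    rw [← Finset.sum_filter, Finset.filter_filter, Finset.sum_const, smul_eq_mul]
  rw [e1, e2]
  exact Finset.sum_congr rfl fun nu hnu => by rw [card_ev hnu]

theorem eN_zero : eN 0 = 1 := by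
  classical
  have h0 : Ev ⊥ := by
    intro i
    have : (⊥ : YoungDiagram).rowLen i = 0 := by
      apply rowLen_eq_of
      intro j
      simp
    simp [this]
  rw [eN, Nat.mul_zero, Y_zero, Finset.filter_true_of_mem (by simpa using h0)]
  simp [fN_bot]

theorem eN_mul (n : ℕ) : eN n * (2 ^ n * n.factorial) = (2 * n).factorial := by
  induction n with
  | zero => simp [eN_zero]
  | succ n ih =>
    rw [show 2 * (n + 1) = (2 * n + 1) + 1 by ring, Nat.factorial_succ (2 * n + 1),
      Nat.factorial_succ (2 * n), ← ih, eN_succ, Nat.factorial_succ n]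
    ring

theorem card_SYT_even_rows (n : ℕ) :
    Nat.card {p : YoungDiagram × (ℕ × ℕ → ℕ) //
        p.1.card = 2 * n ∧ (∀ i, Even (p.1.rowLen i)) ∧ IsSYT p.1 p.2} =
      (2 * n).factorial / (2 ^ n * n.factorial) := by
  classical
  have h1 : Nat.card {p : YoungDiagram × (ℕ × ℕ → ℕ) //
      p.1.card = 2 * n ∧ (∀ i, Even (p.1.rowLen i)) ∧ IsSYT p.1 p.2} = eN n := by
    rw [eN]
    rw [← card_sum_shapes]
    refine Nat.card_congr (Equiv.subtypeEquivRight fun p => ?_)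
    rw [Finset.mem_filter, mem_Y, and_assoc]
    rfl
  rw [h1, ← eN_mul n, Nat.mul_div_cancel]
  positivity
end

section
/- Define the Möbius function on S_n by Moeb(σ) = ∏ᵢ (−1)^{|Cᵢ|−1} c_{|Cᵢ|−1}, where σ = C₁⋯C_k is the cycle decomposition and c_m = (2m)!/(m!(m+1)!) is the Catalan number. Then in the algebra with underlying vector space ℂ[S_n] and multiplication δ_σ ⋆ δ_ρ = δ_{σρ} if |σρ| = |σ|+|ρ| and 0 otherwise, the element μ = Σ_σ Moeb(σ) δ_σ is the two-sided inverse of ζ = Σ_σ δ_σ. -/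
open scoped Classical

/-- The minimal number of transpositions needed to write a permutation
as a product of transpositions. -/
noncomputable def permLength {α : Type*} [DecidableEq α] (σ : Equiv.Perm α) : ℕ :=
  sInf {k | ∃ l : List (Equiv.Perm α), l.length = k ∧ (∀ τ ∈ l, τ.IsSwap) ∧ l.prod = σ}

/-- The multiplication of the Biane algebra on `ℂ[S_n]`:
`δ_σ ⋆ δ_τ = δ_{στ}` when `|στ| = |σ| + |τ|`, and `0` otherwise. -/
noncomputable def bianeMul {n : ℕ} (a b : Equiv.Perm (Fin n) → ℂ) :
    Equiv.Perm (Fin n) → ℂ :=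
  fun ρ => ∑ σ : Equiv.Perm (Fin n), ∑ τ : Equiv.Perm (Fin n),
    if σ * τ = ρ ∧ permLength σ + permLength τ = permLength ρ then a σ * b τ else 0

/-- The Möbius function `Moeb(σ) = ∏ᵢ (-1)^{|Cᵢ|-1} c_{|Cᵢ|-1}` over the cycles of `σ`
(`c_m` the Catalan number; fixed points contribute a factor `1`). -/
noncomputable def Moeb {n : ℕ} (σ : Equiv.Perm (Fin n)) : ℂ :=
  (σ.cycleType.map (fun c => (-1 : ℂ) ^ (c - 1) * (catalan (c - 1) : ℂ))).prod

/-- The zeta function `ζ = Σ_σ δ_σ`. -/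
noncomputable def zetaFn {n : ℕ} : Equiv.Perm (Fin n) → ℂ := fun _ => 1

/-- Multiplicative weight of a permutation: product of `f c` over nontrivial cycles. -/
noncomputable def cycW {α M : Type*} [Fintype α] [DecidableEq α] [CommMonoid M]
    (f : ℕ → M) (σ : Equiv.Perm α) : M := (σ.cycleType.map f).prod

theorem formPerm_append_aux {α : Type*} [DecidableEq α] (l : List α) (a : α) (m : List α) :
    (l ++ a :: m).formPerm = (l ++ [a]).formPerm * (a :: m).formPerm := by
  induction l with
  | nil => simp
  | cons x l ih =>
    cases l with
    | nil => simp
    | cons y l =>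
      simp only [List.cons_append, List.formPerm_cons_cons] at ih ⊢
      rw [ih, mul_assoc]

theorem swap_mul_formPerm {α : Type*} [DecidableEq α] (x y : α) (l₁ l₂ : List α)
    (h : (x :: l₁ ++ y :: l₂).Nodup) :
    Equiv.swap x y * (x :: l₁ ++ y :: l₂).formPerm
      = (x :: l₁).formPerm * (y :: l₂).formPerm := by
  have hy : y ∉ x :: l₁ := by
    intro hy
    exact (List.nodup_append.1 h).2.2 y hy y (by simp) rfl
  obtain ⟨l, a, hl⟩ : ∃ l a, x :: l₁ = l ++ [a] :=
    ⟨(x :: l₁).dropLast, (x :: l₁).getLast (by simp), by simp [List.dropLast_append_getLast]⟩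
  have ha : (x :: l₁).formPerm a = x := by
    have := List.formPerm_apply_getLast x l₁
    have h2 : (x :: l₁).getLast (by simp) = a := by simp [hl]
    rwa [h2] at this
  have hyy : (x :: l₁).formPerm y = y := List.formPerm_apply_of_notMem hy
  have h1 : (x :: l₁ ++ y :: l₂).formPerm
      = (x :: l₁).formPerm * (Equiv.swap a y * (y :: l₂).formPerm) := by
    rw [hl, List.append_assoc, List.singleton_append, formPerm_append_aux,
      List.formPerm_cons_cons]
  rw [h1, ← mul_assoc ((x :: l₁).formPerm), Equiv.mul_swap_eq_swap_mul, ha, hyy, ← mul_assoc,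
    ← mul_assoc, Equiv.swap_mul_self, one_mul]

theorem cycW_formPerm_mul {α M : Type*} [Fintype α] [DecidableEq α] [CommMonoid M]
    (f : ℕ → M) (hf : f 1 = 1) (l : List α) (hl : l.Nodup) (hne : l ≠ [])
    (g : Equiv.Perm α) (hg : ∀ x ∈ l, g x = x) :
    cycW f (l.formPerm * g) = f l.length * cycW f g := by
  have hd : Equiv.Perm.Disjoint l.formPerm g := by
    intro x
    by_cases hx : x ∈ l
    · exact Or.inr (hg x hx)
    · exact Or.inl (List.formPerm_apply_of_notMem hx)
  unfold cycW
  rw [hd.cycleType_mul, Multiset.map_add, Multiset.prod_add]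
  congr 1
  by_cases h2 : 2 ≤ l.length
  · rw [(List.isCycle_formPerm hl h2).cycleType, List.support_formPerm_of_nodup l hl]
    · simp [List.toFinset_card_of_nodup hl]
    · rintro x rfl
      simp at h2
  · have h1 : l.length = 1 := by
      have := List.length_pos_iff.2 hne
      omega
    rw [(List.formPerm_eq_one_iff l hl).2 h1.le, h1, hf]
    simp

theorem exists_cycle_decomp {α : Type*} [Fintype α] [DecidableEq α]
    (ρ : Equiv.Perm α) (k : α) :
    ∃ (l : List α) (g : Equiv.Perm α), (k :: l).Nodup ∧ ρ = (k :: l).formPerm * g ∧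
      (∀ x ∈ k :: l, g x = x) ∧ ∀ i, ρ.SameCycle k i ↔ i ∈ k :: l := by
  by_cases hk : ρ k = k
  · refine ⟨[], ρ, by simp, by simp, by simpa using hk, ?_⟩
    intro i
    simp only [List.mem_singleton]
    constructor
    · rintro ⟨j, rfl⟩
      exact Equiv.Perm.zpow_apply_eq_self_of_apply_eq_self hk j
    · rintro rfl
      exact Equiv.Perm.SameCycle.refl _ _
  · have hks : k ∈ ρ.support := Equiv.Perm.mem_support.2 hk
    have hpos := Equiv.Perm.length_toList_pos_of_mem_support ρ k hks
    obtain ⟨a, l, hL⟩ := List.exists_cons_of_length_pos hpos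
    have ha : a = k := by
      have := Equiv.Perm.toList_getElem_zero ρ k hks
      simpa [hL] using this
    subst ha
    have hmem : ∀ i, ρ.SameCycle a i ↔ i ∈ a :: l := by
      intro i
      rw [← hL, Equiv.Perm.mem_toList_iff]
      simp [hk]
    refine ⟨l, (ρ.cycleOf a)⁻¹ * ρ, hL ▸ Equiv.Perm.nodup_toList ρ a, ?_, ?_, hmem⟩
    · rw [← hL, Equiv.Perm.formPerm_toList]
      simp
    · intro x hx
      have := ((hmem x).2 hx).cycleOf_apply
      rw [Equiv.Perm.mul_apply, Equiv.Perm.inv_eq_iff_eq, this]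

/-- splitting a cycle by a transposition -/
theorem cycW_swap_mul {α M : Type*} [Fintype α] [DecidableEq α] [CommMonoid M]
    (f : ℕ → M) (hf : f 1 = 1) (x y : α) (l₁ l₂ : List α)
    (h : (x :: l₁ ++ y :: l₂).Nodup) (g : Equiv.Perm α)
    (hg : ∀ z ∈ x :: l₁ ++ y :: l₂, g z = z) :
    cycW f (Equiv.swap x y * ((x :: l₁ ++ y :: l₂).formPerm * g))
      = f (l₁.length + 1) * (f (l₂.length + 1) * cycW f g) := by
  have hn := List.nodup_append.1 h
  rw [← mul_assoc, swap_mul_formPerm x y l₁ l₂ h, mul_assoc,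
    cycW_formPerm_mul f hf _ hn.1 (by simp), cycW_formPerm_mul f hf _ hn.2.1 (by simp)]
  · simp
  · intro z hz
    exact hg z (List.mem_append_right _ hz)
  · intro z hz
    rw [Equiv.Perm.mul_apply, hg z (List.mem_append_left _ hz)]
    apply List.formPerm_apply_of_notMem
    intro hz'
    exact hn.2.2 z hz z hz' rfl

/-- length through cycle type -/
noncomputable def cycLen {α : Type*} [Fintype α] [DecidableEq α] (σ : Equiv.Perm α) : ℕ :=
  (cycW (fun c => Multiplicative.ofAdd (c - 1)) σ).toAdd

theorem cycLen_swap_same {α : Type*} [Fintype α] [DecidableEq α] (ρ : Equiv.Perm α) (x y : α)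
    (hxy : x ≠ y) (h : ρ.SameCycle x y) : cycLen (Equiv.swap x y * ρ) + 1 = cycLen ρ := by
  obtain ⟨l, g, hn, hρ, hg, hs⟩ := exists_cycle_decomp ρ x
  have hy : y ∈ l := by
    rcases List.mem_cons.1 ((hs y).1 h) with h | h
    · exact absurd h.symm hxy
    · exact h
  obtain ⟨l₁, l₂, rfl⟩ := List.append_of_mem hy
  rw [← List.cons_append] at hn hρ hg
  unfold cycLen
  rw [hρ, cycW_swap_mul _ (by simp) x y l₁ l₂ hn g hg,
    cycW_formPerm_mul _ (by simp) _ hn (by simp) g hg]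
  simp
  omega

theorem cycLen_swap_not_same {α : Type*} [Fintype α] [DecidableEq α] (ρ : Equiv.Perm α) (x y : α)
    (h : ¬ ρ.SameCycle x y) : cycLen (Equiv.swap x y * ρ) = cycLen ρ + 1 := by
  have hxy : x ≠ y := by
    rintro rfl
    exact h (Equiv.Perm.SameCycle.refl _ _)
  obtain ⟨l₁, g, hn, hρ, hg, hs⟩ := exists_cycle_decomp ρ x
  obtain ⟨l₂, g', hn', hg', hgg, hs'⟩ := exists_cycle_decomp g y
  have hyl : y ∉ x :: l₁ := fun hy => h ((hs y).2 hy)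
  have hdis : ∀ z ∈ x :: l₁, z ∉ y :: l₂ := by
    intro z hz hz'
    have h1 := (hs' z).2 hz'
    have h2 : g z = z := hg z hz
    obtain ⟨j, hj⟩ := h1.symm
    rw [Equiv.Perm.zpow_apply_eq_self_of_apply_eq_self h2 j] at hj
    exact hyl (hj ▸ hz)
  have hnn : (x :: l₁ ++ y :: l₂).Nodup := by
    rw [List.nodup_append]
    refine ⟨hn, hn', ?_⟩
    rintro a ha b hb rfl
    exact hdis a ha hb
  have hfix : ∀ z ∈ x :: l₁, g' z = z := by
    intro z hz
    have h2 : g z = z := hg z hz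
    rw [hg', Equiv.Perm.mul_apply] at h2
    by_cases hz' : g' z ∈ y :: l₂
    · have h3 := List.formPerm_apply_mem_of_mem hz'
      rw [h2] at h3
      exact absurd h3 (hdis z hz)
    · rwa [List.formPerm_apply_of_notMem hz'] at h2
  have key : Equiv.swap x y * ρ = (x :: l₁ ++ y :: l₂).formPerm * g' := by
    rw [hρ, hg', ← mul_assoc (List.formPerm _), ← swap_mul_formPerm x y l₁ l₂ hnn, ← mul_assoc,
      ← mul_assoc, Equiv.swap_mul_self, one_mul]
  have key2 : ρ = Equiv.swap x y * ((x :: l₁ ++ y :: l₂).formPerm * g') := by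
    rw [← key, ← mul_assoc, Equiv.swap_mul_self, one_mul]
  have hfix2 : ∀ z ∈ x :: l₁ ++ y :: l₂, g' z = z := by
    intro z hz
    rcases List.mem_append.1 hz with hz | hz
    · exact hfix z hz
    · exact hgg z hz
  rw [key]
  conv_rhs => rw [key2]
  unfold cycLen
  rw [cycW_swap_mul _ (by simp) x y l₁ l₂ hnn g' hfix2,
    cycW_formPerm_mul _ (by simp) _ hnn (by simp) g' hfix2]
  simp
  omega

theorem cycLen_one {α : Type*} [Fintype α] [DecidableEq α] : cycLen (1 : Equiv.Perm α) = 0 := by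
  simp [cycLen, cycW]

theorem cycLen_le_of_list {α : Type*} [Fintype α] [DecidableEq α] (l : List (Equiv.Perm α))
    (hl : ∀ τ ∈ l, τ.IsSwap) : cycLen l.prod ≤ l.length := by
  induction l with
  | nil => simp [cycLen_one]
  | cons a l ih =>
    have h1 := ih (fun τ hτ => hl τ (List.mem_cons_of_mem _ hτ))
    obtain ⟨x, y, hxy, rfl⟩ := hl a (by simp)
    rw [List.prod_cons, List.length_cons]
    by_cases h : l.prod.SameCycle x y
    · have := cycLen_swap_same _ x y hxy h
      omega
    · have := cycLen_swap_not_same _ x y h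
      omega

theorem exists_list_cycLen {α : Type*} [Fintype α] [DecidableEq α] (m : ℕ) :
    ∀ σ : Equiv.Perm α, cycLen σ = m → ∃ l : List (Equiv.Perm α), l.length = m ∧
      (∀ τ ∈ l, τ.IsSwap) ∧ l.prod = σ := by
  induction m with
  | zero =>
    intro σ h
    refine ⟨[], rfl, by simp, ?_⟩
    by_contra hne
    obtain ⟨x, hx⟩ : ∃ x, σ x ≠ x := by
      by_contra hc
      push Not at hc
      exact hne (Equiv.ext fun x => by simp [hc x])
    have := cycLen_swap_same σ x (σ x) hx.symm (Equiv.Perm.sameCycle_apply_right.2 (Equiv.Perm.SameCycle.refl _ _))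
    omega
  | succ m ih =>
    intro σ h
    obtain ⟨x, hx⟩ : ∃ x, σ x ≠ x := by
      by_contra hc
      push Not at hc
      have : σ = 1 := Equiv.ext fun x => by simp [hc x]
      rw [this, cycLen_one] at h
      omega
    have h2 := cycLen_swap_same σ x (σ x) hx.symm (Equiv.Perm.sameCycle_apply_right.2 (Equiv.Perm.SameCycle.refl _ _))
    obtain ⟨l, hl, hs, hp⟩ := ih (Equiv.swap x (σ x) * σ) (by omega)
    refine ⟨Equiv.swap x (σ x) :: l, by simp [hl], ?_, ?_⟩
    · intro τ hτ
      rcases List.mem_cons.1 hτ with rfl | hτ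
      · exact ⟨x, σ x, hx.symm, rfl⟩
      · exact hs τ hτ
    · rw [List.prod_cons, hp, ← mul_assoc, Equiv.swap_mul_self, one_mul]

theorem permLength_eq {α : Type*} [Fintype α] [DecidableEq α] (σ : Equiv.Perm α) :
    permLength σ = cycLen σ := by
  unfold permLength
  apply le_antisymm
  · exact Nat.sInf_le (exists_list_cycLen _ σ rfl)
  · apply le_csInf
    · exact ⟨_, exists_list_cycLen _ σ rfl⟩
    · rintro k ⟨l, rfl, hs, rfl⟩
      exact cycLen_le_of_list l hs

theorem permLength_mul_le {α : Type*} [Fintype α] [DecidableEq α] (σ τ : Equiv.Perm α) :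
    permLength (σ * τ) ≤ permLength σ + permLength τ := by
  rw [permLength_eq σ, permLength_eq τ]
  obtain ⟨l, hl, hs, hp⟩ := exists_list_cycLen _ σ rfl
  obtain ⟨m, hm, hs', hp'⟩ := exists_list_cycLen _ τ rfl
  apply Nat.sInf_le
  refine ⟨l ++ m, by simp [hl, hm], ?_, by simp [hp, hp']⟩
  intro t ht
  rcases List.mem_append.1 ht with h | h
  · exact hs t h
  · exact hs' t h

theorem permLength_inv {α : Type*} [Fintype α] [DecidableEq α] (σ : Equiv.Perm α) :
    permLength σ⁻¹ = permLength σ := by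
  simp [permLength_eq, cycLen, cycW]

theorem permLength_one {α : Type*} [Fintype α] [DecidableEq α] :
    permLength (1 : Equiv.Perm α) = 0 := by
  rw [permLength_eq, cycLen_one]

theorem permLength_swap {α : Type*} [Fintype α] [DecidableEq α] (x y : α) (h : x ≠ y) :
    permLength (Equiv.swap x y) = 1 := by
  have := cycLen_swap_not_same 1 x y (by
    rintro ⟨j, hj⟩
    exact h (by simpa using hj))
  rw [cycLen_one, mul_one] at this
  rw [permLength_eq, this]

theorem permLength_swap_iff {α : Type*} [Fintype α] [DecidableEq α] (ρ : Equiv.Perm α) (x y : α)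
    (hxy : x ≠ y) : permLength (Equiv.swap x y) + permLength (Equiv.swap x y * ρ) = permLength ρ
      ↔ ρ.SameCycle x y := by
  rw [permLength_swap x y hxy, permLength_eq, permLength_eq]
  constructor
  · intro h
    by_contra hc
    have := cycLen_swap_not_same ρ x y hc
    omega
  · intro h
    have := cycLen_swap_same ρ x y hxy h
    omega

/-- the local Moebius factor -/
noncomputable def mf (c : ℕ) : ℂ := (-1 : ℂ) ^ (c - 1) * (catalan (c - 1) : ℂ)

theorem Moeb_eq_cycW {n : ℕ} (σ : Equiv.Perm (Fin n)) : Moeb σ = cycW mf σ := rfl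

theorem mf_one : mf 1 = 1 := by simp [mf]

theorem mf_rec (m : ℕ) :
    mf (m + 2) + ∑ j : Fin (m + 1), mf (j + 1) * mf (m + 1 - j) = 0 := by
  have h : ∀ j : Fin (m + 1), mf (j + 1) * mf (m + 1 - j)
      = (-1 : ℂ) ^ m * ((catalan j * catalan (m - j) : ℕ) : ℂ) := by
    intro j
    have hj := j.2
    have e : m + 1 - (j : ℕ) - 1 = m - j := by omega
    have e2 : (-1 : ℂ) ^ m = (-1) ^ (j : ℕ) * (-1) ^ (m - (j : ℕ)) := by
      rw [← pow_add]; congr 1; omega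
    simp only [mf, e, Nat.add_sub_cancel, e2]
    push_cast
    ring
  rw [Finset.sum_congr rfl (fun j _ => h j), ← Finset.mul_sum, ← Nat.cast_sum]
  have := catalan_succ m
  rw [Nat.succ_eq_add_one] at this
  rw [← this]
  simp [mf, pow_succ]

theorem Moeb_swap_sum {n : ℕ} (ρ : Equiv.Perm (Fin n)) (k : Fin n) :
    (∑ i : Fin n, if permLength (Equiv.swap k i) + permLength (Equiv.swap k i * ρ) = permLength ρ
      then Moeb (Equiv.swap k i * ρ) else 0) = if ρ k = k then Moeb ρ else 0 := by
  obtain ⟨l, g, hn, hρ, hg, hs⟩ := exists_cycle_decomp ρ k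
  have hkl : k ∉ l := (List.nodup_cons.1 hn).1
  have hnl : l.Nodup := (List.nodup_cons.1 hn).2
  have h1 : (∑ i : Fin n, if permLength (Equiv.swap k i) + permLength (Equiv.swap k i * ρ)
      = permLength ρ then Moeb (Equiv.swap k i * ρ) else 0)
      = Moeb ρ + ∑ j : Fin l.length, Moeb (Equiv.swap k l[j] * ρ) := by
    have hc : ∀ i : Fin n, (permLength (Equiv.swap k i) + permLength (Equiv.swap k i * ρ)
      = permLength ρ) ↔ i ∈ (k :: l).toFinset := by
      intro i
      rw [List.mem_toFinset, ← hs i]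
      by_cases hik : k = i
      · subst hik
        simp [permLength_one, ← Equiv.Perm.one_def, Equiv.Perm.SameCycle.refl]
      · exact permLength_swap_iff ρ k i hik
    simp_rw [hc]
    rw [Finset.sum_ite_mem, Finset.univ_inter, List.sum_toFinset _ hn, List.map_cons,
      List.sum_cons]
    congr 1
    · rw [Equiv.swap_self, ← Equiv.Perm.one_def, one_mul]
    · exact (Fin.sum_univ_fun_getElem l (fun i => Moeb (Equiv.swap k i * ρ))).symm
  have h2 : ∀ j : Fin l.length, Moeb (Equiv.swap k l[j] * ρ)
      = mf (j + 1) * mf (l.length - j) * cycW mf g := by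
    intro j
    have hj := j.2
    have hl : k :: l = k :: l.take j ++ l[j] :: l.drop (j + 1) := by simp
    rw [hρ, Moeb_eq_cycW]
    rw [hl] at hn hg ⊢
    rw [cycW_swap_mul mf mf_one _ _ _ _ hn g hg, ← mul_assoc]
    congr 3
    · simp [hj.le]
    · simp; omega
  have h3 : Moeb ρ = mf (l.length + 1) * cycW mf g := by
    rw [Moeb_eq_cycW]
    conv_lhs => rw [hρ]
    rw [cycW_formPerm_mul mf mf_one _ hn (by simp) g hg, List.length_cons]
  have h4 : ρ k = k ↔ l = [] := by
    rw [hρ, Equiv.Perm.mul_apply, hg k (by simp), List.formPerm_apply_mem_eq_self_iff _ hn _ (by simp)]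
    simp
  rw [h1, Finset.sum_congr rfl (fun j _ => h2 j), ← Finset.sum_mul]
  by_cases hl : l = []
  · rw [if_pos (h4.2 hl)]
    subst hl
    simp
  · rw [if_neg (fun h => hl (h4.1 h)), h3, ← add_mul]
    obtain ⟨m, hm⟩ : ∃ m, l.length = m + 1 :=
      ⟨l.length - 1, by have := List.length_pos_iff.2 hl; omega⟩
    rw [hm, mf_rec m, zero_mul]

theorem bianeMul_left_triple {n : ℕ} (a b c : Equiv.Perm (Fin n) → ℂ) (ρ : Equiv.Perm (Fin n)) :
    bianeMul (bianeMul a b) c ρ = ∑ σ : Equiv.Perm (Fin n),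
      ∑ τ : Equiv.Perm (Fin n), ∑ υ : Equiv.Perm (Fin n),
      if σ * τ * υ = ρ ∧ permLength σ + permLength τ + permLength υ = permLength ρ
        then a σ * b τ * c υ else 0 := by
  have key : ∀ π υ : Equiv.Perm (Fin n), (if π * υ = ρ ∧ permLength π + permLength υ = permLength ρ
      then bianeMul a b π * c υ else 0) = ∑ σ : Equiv.Perm (Fin n), ∑ τ : Equiv.Perm (Fin n),
      if σ * τ = π then
        (if σ * τ * υ = ρ ∧ permLength σ + permLength τ + permLength υ = permLength ρ
          then a σ * b τ * c υ else 0) else 0 := by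
    intro π υ
    have h1 : (if π * υ = ρ ∧ permLength π + permLength υ = permLength ρ
      then bianeMul a b π * c υ else 0) = ∑ σ : Equiv.Perm (Fin n), ∑ τ : Equiv.Perm (Fin n),
      (if π * υ = ρ ∧ permLength π + permLength υ = permLength ρ
      then (if σ * τ = π ∧ permLength σ + permLength τ = permLength π then a σ * b τ else 0) * c υ
        else 0) := by
      unfold bianeMul
      split_ifs
      · simp only [Finset.sum_mul]
      · simp
    rw [h1]
    refine Finset.sum_congr rfl fun σ _ => Finset.sum_congr rfl fun τ _ => ?_
    by_cases hp : σ * τ = π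
    · subst hp
      have t1 := permLength_mul_le σ τ
      have t2 := permLength_mul_le (σ * τ) υ
      by_cases hr : σ * τ * υ = ρ
      · subst hr
        by_cases hl : permLength σ + permLength τ + permLength υ = permLength (σ * τ * υ)
        · have e1 : permLength σ + permLength τ = permLength (σ * τ) := by omega
          have e2 : permLength (σ * τ) + permLength υ = permLength (σ * τ * υ) := by omega
          simp [e1, e2]
        · by_cases e2 : permLength (σ * τ) + permLength υ = permLength (σ * τ * υ)
          · have e1 : ¬ permLength σ + permLength τ = permLength (σ * τ) := by omega
            simp [hl, e1]
          · simp [hl, e2]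
      · simp [hr]
    · simp [hp]
  have h0 : bianeMul (bianeMul a b) c ρ = ∑ π : Equiv.Perm (Fin n), ∑ υ : Equiv.Perm (Fin n),
    (if π * υ = ρ ∧ permLength π + permLength υ = permLength ρ
      then bianeMul a b π * c υ else 0) := rfl
  rw [h0, Finset.sum_comm]
  rw [Finset.sum_congr rfl (fun υ _ => Finset.sum_congr rfl (fun π _ => key π υ))]
  symm
  rw [Finset.sum_congr rfl (fun σ _ => Finset.sum_comm), Finset.sum_comm]
  refine Finset.sum_congr rfl fun υ _ => ?_
  symm
  rw [Finset.sum_comm]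
  refine Finset.sum_congr rfl fun σ _ => ?_
  rw [Finset.sum_comm]
  refine Finset.sum_congr rfl fun τ _ => ?_
  rw [Finset.sum_ite_eq]
  simp

theorem bianeMul_right_triple {n : ℕ} (a b c : Equiv.Perm (Fin n) → ℂ) (ρ : Equiv.Perm (Fin n)) :
    bianeMul a (bianeMul b c) ρ = ∑ σ : Equiv.Perm (Fin n),
      ∑ τ : Equiv.Perm (Fin n), ∑ υ : Equiv.Perm (Fin n),
      if σ * τ * υ = ρ ∧ permLength σ + permLength τ + permLength υ = permLength ρ
        then a σ * b τ * c υ else 0 := by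
  have key : ∀ σ π : Equiv.Perm (Fin n), (if σ * π = ρ ∧ permLength σ + permLength π = permLength ρ
      then a σ * bianeMul b c π else 0) = ∑ τ : Equiv.Perm (Fin n), ∑ υ : Equiv.Perm (Fin n),
      if τ * υ = π then
        (if σ * τ * υ = ρ ∧ permLength σ + permLength τ + permLength υ = permLength ρ
          then a σ * b τ * c υ else 0) else 0 := by
    intro σ π
    have h1 : (if σ * π = ρ ∧ permLength σ + permLength π = permLength ρ
      then a σ * bianeMul b c π else 0) = ∑ τ : Equiv.Perm (Fin n), ∑ υ : Equiv.Perm (Fin n),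
      (if σ * π = ρ ∧ permLength σ + permLength π = permLength ρ
      then a σ * (if τ * υ = π ∧ permLength τ + permLength υ = permLength π then b τ * c υ else 0)
        else 0) := by
      unfold bianeMul
      split_ifs
      · simp only [Finset.mul_sum]
      · simp
    rw [h1]
    refine Finset.sum_congr rfl fun τ _ => Finset.sum_congr rfl fun υ _ => ?_
    by_cases hp : τ * υ = π
    · subst hp
      have t1 := permLength_mul_le τ υ
      have t2 := permLength_mul_le σ (τ * υ)
      by_cases hr : σ * τ * υ = ρ
      · subst hr
        rw [← mul_assoc] at t2 ⊢
        by_cases hl : permLength σ + permLength τ + permLength υ = permLength (σ * τ * υ)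
        · have e1 : permLength τ + permLength υ = permLength (τ * υ) := by omega
          have e2 : permLength σ + permLength (τ * υ) = permLength (σ * τ * υ) := by omega
          simp [hl, e1, e2, mul_assoc]
        · by_cases e2 : permLength σ + permLength (τ * υ) = permLength (σ * τ * υ)
          · have e1 : ¬ permLength τ + permLength υ = permLength (τ * υ) := by omega
            simp [hl, e1]
          · simp [hl, e2]
      · simp [hr, ← mul_assoc]
    · simp [hp]
  have h0 : bianeMul a (bianeMul b c) ρ = ∑ σ : Equiv.Perm (Fin n), ∑ π : Equiv.Perm (Fin n),
    (if σ * π = ρ ∧ permLength σ + permLength π = permLength ρ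
      then a σ * bianeMul b c π else 0) := rfl
  rw [h0]
  refine Finset.sum_congr rfl fun σ _ => ?_
  rw [Finset.sum_congr rfl (fun π _ => key σ π), Finset.sum_comm]
  refine Finset.sum_congr rfl fun τ _ => ?_
  rw [Finset.sum_comm]
  refine Finset.sum_congr rfl fun υ _ => ?_
  rw [Finset.sum_ite_eq]
  simp

theorem bianeMul_assoc {n : ℕ} (a b c : Equiv.Perm (Fin n) → ℂ) :
    bianeMul (bianeMul a b) c = bianeMul a (bianeMul b c) := by
  funext ρ
  rw [bianeMul_left_triple, bianeMul_right_triple]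

/-- `ρ` fixes all points with index at least `k` -/
def FixGe {n : ℕ} (k : ℕ) (ρ : Equiv.Perm (Fin n)) : Prop := ∀ x : Fin n, k ≤ (x : ℕ) → ρ x = x

noncomputable def zK {n : ℕ} (k : ℕ) (ρ : Equiv.Perm (Fin n)) : ℂ := if FixGe k ρ then 1 else 0

noncomputable def mK {n : ℕ} (k : ℕ) (ρ : Equiv.Perm (Fin n)) : ℂ :=
  if FixGe k ρ then Moeb ρ else 0

/-- identity plus Jucys-Murphy element -/
noncomputable def jK {n : ℕ} (k : Fin n) (t : Equiv.Perm (Fin n)) : ℂ :=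
  ∑ i : Fin n, if i ≤ k ∧ t = Equiv.swap k i then 1 else 0

theorem jK_sum {n : ℕ} (k : Fin n) (F : Equiv.Perm (Fin n) → ℂ) :
    ∑ σ : Equiv.Perm (Fin n), jK k σ * F σ
      = ∑ i : Fin n, if i ≤ k then F (Equiv.swap k i) else 0 := by
  unfold jK
  simp_rw [Finset.sum_mul]
  rw [Finset.sum_comm]
  refine Finset.sum_congr rfl fun i _ => ?_
  by_cases hi : i ≤ k <;> simp [hi]

theorem jK_mul {n : ℕ} (k : Fin n) (b : Equiv.Perm (Fin n) → ℂ) (ρ : Equiv.Perm (Fin n)) :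
    bianeMul (jK k) b ρ = ∑ i : Fin n, if i ≤ k then
      (if permLength (Equiv.swap k i) + permLength (Equiv.swap k i * ρ) = permLength ρ
        then b (Equiv.swap k i * ρ) else 0) else 0 := by
  have h := jK_sum k (fun σ => if permLength σ + permLength (σ⁻¹ * ρ) = permLength ρ
        then b (σ⁻¹ * ρ) else 0)
  simp only [Equiv.swap_inv] at h
  refine Eq.trans ?_ (h.trans (Finset.sum_congr rfl fun i _ => by congr))
  unfold bianeMul
  refine Finset.sum_congr rfl fun σ _ => ?_
  rw [Finset.sum_eq_single (σ⁻¹ * ρ)]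
  · simp
  · intro τ _ hτ
    rw [if_neg]
    rintro ⟨h1, -⟩
    exact hτ (by rw [← h1]; simp)
  · simp

theorem mul_jK {n : ℕ} (k : Fin n) (a : Equiv.Perm (Fin n) → ℂ) (ρ : Equiv.Perm (Fin n)) :
    bianeMul a (jK k) ρ = ∑ i : Fin n, if i ≤ k then
      (if permLength (ρ * Equiv.swap k i) + permLength (Equiv.swap k i) = permLength ρ
        then a (ρ * Equiv.swap k i) else 0) else 0 := by
  have h := jK_sum k (fun σ => if permLength (ρ * σ⁻¹) + permLength σ = permLength ρ
        then a (ρ * σ⁻¹) else 0)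
  simp only [Equiv.swap_inv] at h
  refine Eq.trans ?_ (h.trans (Finset.sum_congr rfl fun i _ => by congr))
  unfold bianeMul
  rw [Finset.sum_comm]
  refine Finset.sum_congr rfl fun σ _ => ?_
  rw [Finset.sum_eq_single (ρ * σ⁻¹)]
  · simp [mul_comm]
  · intro τ _ hτ
    rw [if_neg]
    rintro ⟨h1, -⟩
    exact hτ (by rw [← h1]; simp)
  · simp

theorem swap_fix {n : ℕ} (k i x : Fin n) (hi : i ≤ k) (hx : (k : ℕ) + 1 ≤ x) :
    Equiv.swap k i x = x := by
  apply Equiv.swap_apply_of_ne_of_ne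
  · rintro rfl; omega
  · rintro rfl
    have : (x : ℕ) ≤ k := hi
    omega

theorem fixGe_of_succ {n : ℕ} (k : Fin n) (ρ : Equiv.Perm (Fin n)) :
    FixGe k ρ ↔ FixGe (k + 1) ρ ∧ ρ k = k := by
  constructor
  · intro h
    exact ⟨fun x hx => h x (by omega), h k le_rfl⟩
  · rintro ⟨h1, h2⟩ x hx
    by_cases hxk : x = k
    · rw [hxk, h2]
    · exact h1 x (by have : (x : ℕ) ≠ k := fun h => hxk (Fin.ext h)
                     omega)

theorem fixGe_swap_mul {n : ℕ} (k i : Fin n) (hi : i ≤ k) (ρ : Equiv.Perm (Fin n)) :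
    FixGe (k + 1) (Equiv.swap k i * ρ) ↔ FixGe (k + 1) ρ := by
  have one : ∀ ρ : Equiv.Perm (Fin n), FixGe (k + 1) ρ → FixGe (k + 1) (Equiv.swap k i * ρ) := by
    intro ρ h x hx
    rw [Equiv.Perm.mul_apply, h x hx, swap_fix k i x hi hx]
  refine ⟨fun h => ?_, one ρ⟩
  have := one _ h
  rwa [← mul_assoc, Equiv.swap_mul_self, one_mul] at this

theorem fixGe_mul_swap {n : ℕ} (k i : Fin n) (hi : i ≤ k) (ρ : Equiv.Perm (Fin n)) :
    FixGe (k + 1) (ρ * Equiv.swap k i) ↔ FixGe (k + 1) ρ := by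
  have one : ∀ ρ : Equiv.Perm (Fin n), FixGe (k + 1) ρ → FixGe (k + 1) (ρ * Equiv.swap k i) := by
    intro ρ h x hx
    rw [Equiv.Perm.mul_apply, swap_fix k i x hi hx, h x hx]
  refine ⟨fun h => ?_, one ρ⟩
  have := one _ h
  rwa [mul_assoc, Equiv.swap_mul_self, mul_one] at this

theorem jK_mK {n : ℕ} (k : Fin n) : bianeMul (jK k) (mK (k + 1)) = mK k := by
  funext ρ
  rw [jK_mul]
  by_cases h : FixGe (k + 1) ρ
  · have h1 : mK k ρ = if ρ k = k then Moeb ρ else 0 := by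
      simp [mK, fixGe_of_succ, h]
    rw [h1, ← Moeb_swap_sum]
    refine Finset.sum_congr rfl fun i _ => ?_
    by_cases hi : i ≤ k
    · simp [hi, mK, fixGe_swap_mul, h]
    · rw [if_neg hi, if_neg]
      have hki : k ≠ i := by
        rintro rfl
        exact hi le_rfl
      rw [permLength_swap_iff ρ k i hki]
      intro hs
      obtain ⟨j, hj⟩ := hs.symm
      have hii : ρ i = i := h i (by
        have : (k : ℕ) < i := not_le.1 hi
        omega)
      rw [Equiv.Perm.zpow_apply_eq_self_of_apply_eq_self hii j] at hj
      exact hki hj.symm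
  · have h1 : mK k ρ = 0 := by simp [mK, fixGe_of_succ, h]
    rw [h1]
    refine Finset.sum_eq_zero fun i _ => ?_
    by_cases hi : i ≤ k
    · simp [mK, fixGe_swap_mul, h, hi]
    · simp [hi]

theorem zK_jK {n : ℕ} (k : Fin n) : bianeMul (zK k) (jK k) = zK (k + 1) := by
  funext ρ
  rw [mul_jK]
  by_cases h : FixGe (k + 1) ρ
  · have h1 : zK (k + 1) ρ = 1 := by simp [zK, h]
    have hle : ρ⁻¹ k ≤ k := by
      by_contra hc
      have h2 := h (ρ⁻¹ k) (by
        have : (k : ℕ) < (ρ⁻¹ k : Fin n) := not_le.1 hc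
        omega)
      rw [show ρ (ρ⁻¹ k) = k by simp] at h2
      exact hc h2.symm.le
    rw [h1, Finset.sum_eq_single (ρ⁻¹ k)]
    · rw [if_pos hle, if_pos]
      · rw [zK, if_pos]
        rw [fixGe_of_succ, fixGe_mul_swap _ _ hle]
        exact ⟨h, by simp⟩
      · by_cases hk : ρ k = k
        · have : ρ⁻¹ k = k := by rw [Equiv.Perm.inv_eq_iff_eq, hk]
          rw [this, Equiv.swap_self, ← Equiv.Perm.one_def, mul_one, permLength_one, add_zero]
        · have hne : ρ k ≠ ρ (ρ⁻¹ k) := by simpa using hk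
          have hne2 : k ≠ ρ⁻¹ k := fun h => hne (congrArg ρ h)
          have := (permLength_swap_iff ρ (ρ k) (ρ (ρ⁻¹ k)) hne).2 (by
            rw [show ρ (ρ⁻¹ k) = k by simp, Equiv.Perm.sameCycle_apply_left])
          rw [permLength_swap _ _ hne] at this
          rw [Equiv.mul_swap_eq_swap_mul, permLength_swap _ _ hne2, add_comm, this]
    · intro i _ hi
      have : zK k (ρ * Equiv.swap k i) = 0 := by
        rw [zK, if_neg]
        rw [fixGe_of_succ]
        rintro ⟨-, h2⟩
        apply hi
        rw [Equiv.Perm.mul_apply, Equiv.swap_apply_left] at h2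
        rw [eq_comm, Equiv.Perm.inv_eq_iff_eq, h2]
      simp [this]
    · simp
  · have h1 : zK (k + 1) ρ = 0 := by simp [zK, h]
    rw [h1]
    refine Finset.sum_eq_zero fun i _ => ?_
    by_cases hi : i ≤ k
    · simp [zK, fixGe_of_succ, fixGe_mul_swap, h, hi]
    · simp [hi]

theorem zK_mK {n : ℕ} (k : ℕ) (hk : k ≤ n) :
    bianeMul (zK k) (mK k) = fun ρ : Equiv.Perm (Fin n) => if ρ = 1 then 1 else 0 := by
  induction k with
  | zero =>
    have h : ∀ ρ : Equiv.Perm (Fin n), FixGe 0 ρ ↔ ρ = 1 := by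
      intro ρ
      constructor
      · intro h
        exact Equiv.ext fun x => by simpa using h x (Nat.zero_le _)
      · rintro rfl x _
        rfl
    funext ρ
    unfold bianeMul
    rw [Finset.sum_eq_single 1]
    · rw [Finset.sum_eq_single 1]
      · by_cases hρ : ρ = 1
        · simp [hρ, permLength_one, zK, mK, h, Moeb]
        · simp [hρ, Ne.symm hρ]
      · intro τ _ hτ
        simp [mK, h, hτ]
      · simp
    · intro σ _ hσ
      simp [zK, h, hσ]
    · simp
  | succ k ih =>
    have e1 := zK_jK (⟨k, hk⟩ : Fin n)
    have e2 := jK_mK (⟨k, hk⟩ : Fin n)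
    simp only at e1 e2
    rw [← e1, bianeMul_assoc, e2, ih (by omega)]

theorem zeta_mul_moeb {n : ℕ} (ρ : Equiv.Perm (Fin n)) :
    bianeMul zetaFn Moeb ρ = if ρ = 1 then 1 else 0 := by
  have h : ∀ ρ : Equiv.Perm (Fin n), FixGe n ρ := fun ρ x hx => absurd x.2 (by omega)
  have e1 : (zetaFn : Equiv.Perm (Fin n) → ℂ) = zK n := by
    funext ρ; simp [zetaFn, zK, h]
  have e2 : (Moeb : Equiv.Perm (Fin n) → ℂ) = mK n := by
    funext ρ; simp [mK, h]
  rw [e1, e2, zK_mK n le_rfl]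

theorem moeb_mul_zeta {n : ℕ} (ρ : Equiv.Perm (Fin n)) :
    bianeMul Moeb zetaFn ρ = bianeMul zetaFn Moeb ρ⁻¹ := by
  unfold bianeMul
  rw [Finset.sum_comm, ← Equiv.sum_comp (Equiv.inv (Equiv.Perm (Fin n)))]
  refine Finset.sum_congr rfl fun σ _ => ?_
  rw [← Equiv.sum_comp (Equiv.inv (Equiv.Perm (Fin n)))]
  refine Finset.sum_congr rfl fun τ _ => ?_
  have hm : Moeb τ⁻¹ = Moeb τ := by simp [Moeb]
  have hi : τ⁻¹ * σ⁻¹ = ρ ↔ σ * τ = ρ⁻¹ := by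
    rw [← mul_inv_rev, inv_eq_iff_eq_inv]
  simp only [Equiv.inv_apply, permLength_inv, hm, hi, zetaFn, mul_one, one_mul,
    add_comm (permLength τ)]

theorem moeb_is_inverse_of_zeta (n : ℕ) :
    (∀ ρ : Equiv.Perm (Fin n),
      bianeMul zetaFn Moeb ρ = if ρ = 1 then 1 else 0) ∧
    (∀ ρ : Equiv.Perm (Fin n),
      bianeMul Moeb zetaFn ρ = if ρ = 1 then 1 else 0) := by
  refine ⟨fun ρ => zeta_mul_moeb ρ, fun ρ => ?_⟩
  rw [moeb_mul_zeta, zeta_mul_moeb]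
  simp only [inv_eq_one]
end
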